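/- In a two-agent market with two trades, any cycle of the alternating best response dynamic has even length at least 4; in particular there is no cycle of length 2. -/

import Mathlib

open Finset

/-- A trading market: a set `I` of agents, a set `Ω` of bilateral trades, each with a
buyer and a distinct seller, integer-valued valuations over bundles of trades, and a
(unique, tie-broken) demanded bundle at every price vector. -/
structure Market (I Ω : Type) [DecidableEq I] where
  buyer : Ω → I
  seller : Ω → I
  buyer_ne_seller : ∀ ω, buyer ω ≠ seller ω
  v : I → Finset Ω → ℤ
  demand : I → (Ω → ℤ) → Finset Ω
  demand_involves : ∀ i p, ∀ ω ∈ demand i p, buyer ω = i ∨ seller ω = i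
  demand_max : ∀ (i : I) (p : Ω → ℤ) (Ψ : Finset Ω),
    (∀ ω ∈ Ψ, buyer ω = i ∨ seller ω = i) →
    v i Ψ - ∑ ω ∈ Ψ, (if buyer ω = i then (1 : ℤ) else if seller ω = i then -1 else 0) * p ω ≤
      v i (demand i p) -
        ∑ ω ∈ demand i p,
          (if buyer ω = i then (1 : ℤ) else if seller ω = i then -1 else 0) * p ω

/-- A state of the market dynamic: the set of unsatisfied agents and the current offers
`offers i ω` of agent `i` for trade `ω`. -/
structure MState (I Ω : Type) where
  unsat : Finset I
  offers : I → Ω → ℤ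

namespace Market

variable {I Ω : Type} [Fintype I] [DecidableEq I] [Fintype Ω] [DecidableEq Ω]

/-- The sign `χ^i_ω`: `1` if `i` buys `ω`, `-1` if `i` sells `ω`, `0` otherwise. -/
def chi (M : Market I Ω) (i : I) (ω : Ω) : ℤ :=
  if M.buyer ω = i then 1 else if M.seller ω = i then -1 else 0

/-- Quasilinear utility of agent `i` for bundle `Ψ` at prices `p`. -/
def utility (M : Market I Ω) (i : I) (Ψ : Finset Ω) (p : Ω → ℤ) : ℤ :=
  M.v i Ψ - ∑ ω ∈ Ψ, M.chi i ω * p ω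

/-- The valuation of the empty bundle is `0`. -/
def Normalized (M : Market I Ω) : Prop := ∀ i : I, M.v i (∅ : Finset Ω) = 0

/-- The prices facing agent `i`: the counterpart's offer `σ^{-i}_ω` for each trade `ω`. -/
def price (M : Market I Ω) (σ : I → Ω → ℤ) (i : I) (ω : Ω) : ℤ :=
  if M.buyer ω = i then σ (M.seller ω) ω else σ (M.buyer ω) ω

/-- The best response (with step size `ε = 1`) of agent `i` given current offers `σ`:
she matches the counterpart's offer on the trades she demands, and moves off by `1`
(in her favourable direction) otherwise.  Offers of other agents are unchanged. -/
def bestResponse (M : Market I Ω) (σ : I → Ω → ℤ) (i : I) : I → Ω → ℤ := fun j ω =>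
  if j = i ∧ (M.buyer ω = i ∨ M.seller ω = i) then
    (if ω ∈ M.demand i (M.price σ i) then M.price σ i ω
     else M.price σ i ω - M.chi i ω)
  else σ j ω

/-- One step of the market dynamic: agent `i` best responds, becomes satisfied, and all
counterparts facing a modified offer become unsatisfied. -/
def mstep (M : Market I Ω) (s : MState I Ω) (i : I) : MState I Ω :=
  { unsat := (s.unsat.erase i) ∪ (Finset.univ.filter fun j =>
      j ≠ i ∧ ∃ ω : Ω,
        ((M.buyer ω = i ∧ M.seller ω = j) ∨ (M.buyer ω = j ∧ M.seller ω = i)) ∧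
        M.bestResponse s.offers i i ω ≠ s.offers i ω),
    offers := M.bestResponse s.offers i }

/-- Running the dynamic along a finite sequence of best-responding agents. -/
def mrun (M : Market I Ω) : MState I Ω → List I → MState I Ω
  | s, [] => s
  | s, i :: L => M.mrun (M.mstep s i) L

/-- A best response sequence of the dynamic is valid if every selected agent is
unsatisfied when selected. -/
def ValidSeq (M : Market I Ω) : MState I Ω → List I → Prop
  | _, [] => True
  | s, i :: L => i ∈ s.unsat ∧ M.ValidSeq (M.mstep s i) L

/-- A (valid) best response sequence after which the market dynamic terminates, i.e.,
all agents are satisfied. -/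
def TerminatingSeq (M : Market I Ω) (s : MState I Ω) (L : List I) : Prop :=
  M.ValidSeq s L ∧ (M.mrun s L).unsat = ∅

/-- Full substitutability of the demand of agent `i` (Hatfield et al.). -/
def FullySubstitutable (M : Market I Ω) (i : I) : Prop :=
  ∀ p p' : Ω → ℤ,
    (((∀ ω, M.seller ω = i → p ω = p' ω) ∧ (∀ ω, M.buyer ω = i → p' ω ≤ p ω)) →
      ((∀ ω ∈ M.demand i p, M.seller ω = i → ω ∈ M.demand i p') ∧
       (∀ ω ∈ M.demand i p', M.buyer ω = i → p ω = p' ω → ω ∈ M.demand i p))) ∧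
    (((∀ ω, M.buyer ω = i → p ω = p' ω) ∧ (∀ ω, M.seller ω = i → p ω ≤ p' ω)) →
      ((∀ ω ∈ M.demand i p, M.buyer ω = i → ω ∈ M.demand i p') ∧
       (∀ ω ∈ M.demand i p', M.seller ω = i → p ω = p' ω → ω ∈ M.demand i p)))

/-- A market with fully substitutable agents. -/
def FSM (M : Market I Ω) : Prop := ∀ i : I, M.FullySubstitutable i

end Market

namespace Market

variable {Ω : Type} [Fintype Ω] [DecidableEq Ω]

/-- The alternating best response dynamic of a two-agent market, starting with agent `a`:
`altRun M s a n` is the state after `n` best responses. -/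
def altRun (M : Market Bool Ω) : MState Bool Ω → Bool → ℕ → MState Bool Ω
  | s, _, 0 => s
  | s, a, n + 1 => M.altRun (M.mstep s a) (!a) n

/-- The alternating best response dynamic terminates (all agents become satisfied). -/
def AltConverges (M : Market Bool Ω) (s : MState Bool Ω) (a : Bool) : Prop :=
  ∃ n : ℕ, (M.altRun s a n).unsat = ∅

end Market

namespace Market

theorem notMem_unsat_mstep {I Ω : Type} [Fintype I] [DecidableEq I] [Fintype Ω] [DecidableEq Ω]
    (M : Market I Ω) (s : MState I Ω) (i : I) : i ∉ (M.mstep s i).unsat := by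
  simp [mstep]

theorem offers_mstep_of_ne {I Ω : Type} [Fintype I] [DecidableEq I] [Fintype Ω] [DecidableEq Ω]
    (M : Market I Ω) (s : MState I Ω) {i j : I} (h : j ≠ i) :
    (M.mstep s i).offers j = s.offers j := by
  funext ω
  simp [mstep, bestResponse, h]

/-- An agent who becomes unsatisfied faces a modified offer. -/
theorem offers_mstep_ne_of_mem_unsat {I Ω : Type} [Fintype I] [DecidableEq I] [Fintype Ω]
    [DecidableEq Ω] (M : Market I Ω) (s : MState I Ω) {i j : I} (hj : j ∉ s.unsat)
    (h : j ∈ (M.mstep s i).unsat) : (M.mstep s i).offers i ≠ s.offers i := by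
  simp only [mstep, mem_union, mem_erase, hj, and_false, false_or, mem_filter, mem_univ,
    true_and] at h
  obtain ⟨-, ω, -, hω⟩ := h
  exact fun he => hω (congrFun he ω)

variable {Ω : Type} [Fintype Ω] [DecidableEq Ω]

theorem altRun_succ (M : Market Bool Ω) (s : MState Bool Ω) (a : Bool) (n : ℕ) :
    M.altRun s a (n + 1) = M.mstep (M.altRun s a n) (not^[n] a) := by
  induction n generalizing s a with
  | zero => rfl
  | succ n ih => exact ih (M.mstep s a) (!a)

/-- Along a non-terminating run, after at least one step exactly the next agent to move is
unsatisfied. -/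
theorem mem_unsat_altRun_succ (M : Market Bool Ω) (s : MState Bool Ω) (a : Bool)
    (hnt : ¬ M.AltConverges s a) (n : ℕ) (b : Bool) :
    b ∈ (M.altRun s a (n + 1)).unsat ↔ b = not^[n + 1] a := by
  have hprev : (not^[n] a) ∉ (M.altRun s a (n + 1)).unsat := by
    rw [altRun_succ]
    exact notMem_unsat_mstep M _ _
  obtain ⟨c, hc⟩ : (M.altRun s a (n + 1)).unsat.Nonempty :=
    Finset.nonempty_iff_ne_empty.mpr fun h => hnt ⟨n + 1, h⟩
  have key : ∀ x, x ∈ (M.altRun s a (n + 1)).unsat → x = !(not^[n] a) := fun x hx =>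
    Bool.eq_not_of_ne fun h => hprev (h ▸ hx)
  rw [Function.iterate_succ_apply']
  refine ⟨key b, fun h => ?_⟩
  rw [h, ← key c hc]
  exact hc

end Market

/-- In a two-agent market with two trades, any cycle (eventual period) of a
non-terminating alternating best response sequence has even length at least 4; in
particular there is no cycle of length 2. -/
theorem cycle_length_even_and_at_least_four
    (M : Market Bool (Fin 2)) (hN : M.Normalized)
    (s : MState Bool (Fin 2)) (a : Bool)
    (hnt : ¬ M.AltConverges s a) :
    ∀ k : ℕ, 0 < k →
      (∃ N, ∀ n, N ≤ n → M.altRun s a (n + k) = M.altRun s a n) →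
      Even k ∧ 4 ≤ k := by
  rintro k hk ⟨N, hN'⟩
  have heven : Even k := by
    by_contra hodd
    rw [Nat.not_even_iff_odd] at hodd
    have h₁ := (M.mem_unsat_altRun_succ s a hnt N _).mpr rfl
    rw [← hN' (N + 1) (by omega), show N + 1 + k = (N + k) + 1 by omega,
      M.mem_unsat_altRun_succ s a hnt, show N + k + 1 = k + (N + 1) by omega,
      Function.iterate_add_apply not k, Bool.involutive_not.iterate_odd hodd] at h₁
    exact Bool.not_ne_self _ h₁.symm
  refine ⟨heven, ?_⟩
  by_contra hlt
  obtain rfl : k = 2 := by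
    obtain ⟨m, rfl⟩ := heven
    omega
  have hnext : (not^[N + 2] a) = !(not^[N + 1] a) := Function.iterate_succ_apply' not (N + 1) a
  have hmem := (M.mem_unsat_altRun_succ s a hnt (N + 1) _).mpr rfl
  have hnot : (not^[N + 2] a) ∉ (M.altRun s a (N + 1)).unsat := by
    rw [M.mem_unsat_altRun_succ s a hnt, hnext]
    exact Bool.not_ne_self _
  rw [M.altRun_succ s a (N + 1)] at hmem
  refine M.offers_mstep_ne_of_mem_unsat _ hnot hmem ?_
  rw [← M.altRun_succ s a (N + 1)]
  have hne : (not^[N + 1] a) ≠ (not^[N + 2] a) := by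
    rw [hnext]
    exact (Bool.not_ne_self _).symm
  rw [← M.offers_mstep_of_ne _ hne, ← M.altRun_succ s a (N + 2), hN' (N + 1) (by omega)]
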